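/- Let m ≥ 2 and let Φ, Φ₁, …, Φ_m be Young functions. Then the following are equivalent: (1) there exists C > 0 such that ∏_{i=1}^m Φᵢ⁻¹(t) ≤ C·Φ⁻¹(t) for all t ≥ 0; (2) there exists C > 0 such that Φ((∏_{i=1}^m tᵢ)/C) ≤ Σ_{i=1}^m Φᵢ(tᵢ) for all t₁,…,t_m ≥ 0; (3) there exists M > 0 such that ‖∏_{i=1}^m fᵢ‖_{wL_Φ} ≤ M·∏_{i=1}^m ‖fᵢ‖_{wL_{Φᵢ}} for all fᵢ ∈ wL_{Φᵢ}(ℝⁿ), i = 1,…,m; (4) for all fᵢ ∈ wL_{Φᵢ}(ℝⁿ), i = 1,…,m, the product ∏_{i=1}^m fᵢ belongs to wL_Φ(ℝⁿ). -/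

import Mathlib

open MeasureTheory ENNReal Filter

/-- A Young function: convex on `[0,∞)`, left-continuous, `Φ 0 = 0`,
nonnegative on `[0,∞)`, and `Φ t → ∞` as `t → ∞`. -/
structure IsYoung (Φ : ℝ → ℝ) : Prop where
  nonneg : ∀ t, 0 ≤ t → 0 ≤ Φ t
  convexOn : ConvexOn ℝ (Set.Ici 0) Φ
  leftCont : ∀ t, 0 < t → ContinuousWithinAt Φ (Set.Iic t) t
  map_zero : Φ 0 = 0
  tendsto_top : Tendsto Φ atTop atTop

/-- Generalized inverse `Φ⁻¹(s) = inf {r ≥ 0 : Φ r > s}`. -/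
noncomputable def youngInv (Φ : ℝ → ℝ) (s : ℝ) : ℝ :=
  sInf {r : ℝ | 0 ≤ r ∧ s < Φ r}

/-- The set `{b > 0 : ∫ Φ(|f|/b) dμ ≤ 1}` defining the Luxemburg norm. -/
def orliczSet {α : Type*} [MeasurableSpace α] (μ : Measure α) (Φ : ℝ → ℝ)
    (f : α → ℝ) : Set ℝ :=
  {b : ℝ | 0 < b ∧ ∫⁻ x, ENNReal.ofReal (Φ (|f x| / b)) ∂μ ≤ 1}

/-- The Orlicz (Luxemburg) norm `‖f‖_{L_Φ} = inf {b > 0 : ∫ Φ(|f|/b) dμ ≤ 1}`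
(equal to `∞` when no such `b` exists). -/
noncomputable def orliczNorm {α : Type*} [MeasurableSpace α] (μ : Measure α) (Φ : ℝ → ℝ)
    (f : α → ℝ) : ℝ≥0∞ :=
  ⨅ b ∈ orliczSet μ Φ f, ENNReal.ofReal b

/-- `f ∈ L_Φ`: `f` is measurable and some `b > 0` satisfies `∫ Φ(|f|/b) dμ ≤ 1`. -/
def MemOrlicz {α : Type*} [MeasurableSpace α] (μ : Measure α) (Φ : ℝ → ℝ)
    (f : α → ℝ) : Prop :=
  Measurable f ∧ (orliczSet μ Φ f).Nonempty

/-- The set `{b > 0 : sup_{t>0} Φ(t)·μ{|f|/b > t} ≤ 1}` defining the weak Orlicz quasi-norm. -/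
def wOrliczSet {α : Type*} [MeasurableSpace α] (μ : Measure α) (Φ : ℝ → ℝ)
    (f : α → ℝ) : Set ℝ :=
  {b : ℝ | 0 < b ∧ ∀ t > 0, ENNReal.ofReal (Φ t) * μ {x | t < |f x| / b} ≤ 1}

/-- The weak Orlicz quasi-norm `‖f‖_{wL_Φ}` (equal to `∞` when no admissible `b` exists). -/
noncomputable def wOrliczNorm {α : Type*} [MeasurableSpace α] (μ : Measure α) (Φ : ℝ → ℝ)
    (f : α → ℝ) : ℝ≥0∞ :=
  ⨅ b ∈ wOrliczSet μ Φ f, ENNReal.ofReal b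

/-- `f ∈ wL_Φ`: `f` is measurable and `‖f‖_{wL_Φ} < ∞`. -/
def MemwOrlicz {α : Type*} [MeasurableSpace α] (μ : Measure α) (Φ : ℝ → ℝ)
    (f : α → ℝ) : Prop :=
  Measurable f ∧ wOrliczNorm μ Φ f < ⊤

namespace IsYoung

variable {Φ : ℝ → ℝ}

theorem map_mul_le (h : IsYoung Φ) {c t : ℝ} (hc : 0 ≤ c) (hc1 : c ≤ 1) (ht : 0 ≤ t) :
    Φ (c * t) ≤ c * Φ t := by
  have := h.convexOn.2 (x := t) (y := 0) ht (Set.mem_Ici.2 le_rfl) hc (sub_nonneg.2 hc1)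
    (by ring)
  simpa [h.map_zero] using this

theorem mono (h : IsYoung Φ) {a b : ℝ} (ha : 0 ≤ a) (hab : a ≤ b) : Φ a ≤ Φ b := by
  rcases ha.eq_or_lt with rfl | ha'
  · rw [h.map_zero]; exact h.nonneg b hab
  have hb : 0 < b := ha'.trans_le hab
  have h1 : a / b ≤ 1 := (div_le_one hb).2 hab
  have := h.map_mul_le (div_nonneg ha hb.le) h1 hb.le
  rw [div_mul_cancel₀ a hb.ne'] at this
  exact this.trans (mul_le_of_le_one_left (h.nonneg b hb.le) h1)

theorem youngInv_set_nonempty (h : IsYoung Φ) (s : ℝ) :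
    {r : ℝ | 0 ≤ r ∧ s < Φ r}.Nonempty := by
  obtain ⟨r, h1, h2⟩ := ((Filter.eventually_ge_atTop 0).and
    (h.tendsto_top.eventually_gt_atTop s)).exists
  exact ⟨r, h1, h2⟩

theorem monotone_youngInv (h : IsYoung Φ) : Monotone (youngInv Φ) := fun _ s hs =>
  csInf_le_csInf ⟨0, fun _ hr => hr.1⟩ (h.youngInv_set_nonempty s)
    fun _ hr => ⟨hr.1, hs.trans_lt hr.2⟩

theorem youngInv_nonneg (h : IsYoung Φ) (s : ℝ) : 0 ≤ youngInv Φ s :=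
  le_csInf (h.youngInv_set_nonempty s) fun _ hr => hr.1

theorem le_of_lt_youngInv {r s : ℝ} (hr : 0 ≤ r) (hrs : r < youngInv Φ s) :
    Φ r ≤ s := by
  by_contra! hlt
  exact hrs.not_ge (csInf_le ⟨0, fun _ hx => hx.1⟩ ⟨hr, hlt⟩)

theorem lt_of_youngInv_lt (h : IsYoung Φ) {r s : ℝ} (hrs : youngInv Φ s < r) :
    s < Φ r := by
  obtain ⟨r', hr', hlt⟩ := exists_lt_of_csInf_lt (h.youngInv_set_nonempty s) hrs
  exact hr'.2.trans_le (h.mono hr'.1 hlt.le)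

theorem le_youngInv (h : IsYoung Φ) {r s : ℝ} (hrs : Φ r ≤ s) : r ≤ youngInv Φ s :=
  le_of_not_gt fun hlt => (h.lt_of_youngInv_lt hlt).not_ge hrs

theorem map_youngInv_le (h : IsYoung Φ) {s : ℝ} (hs : 0 ≤ s) : Φ (youngInv Φ s) ≤ s := by
  rcases (h.youngInv_nonneg s).eq_or_lt with h0 | h0
  · rwa [← h0, h.map_zero]
  · have hc := (h.leftCont _ h0).mono (Set.Iio_subset_Iic_self)
    refine le_of_tendsto hc ?_
    filter_upwards [Ioo_mem_nhdsLT h0] with r hr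
    exact le_of_lt_youngInv hr.1.le hr.2

theorem youngInv_pos (h : IsYoung Φ) {s : ℝ} (hs : 0 < s) : 0 < youngInv Φ s := by
  have h1 := h.nonneg 1 zero_le_one
  have hp : 0 < s + Φ 1 := by linarith
  refine lt_of_lt_of_le (div_pos hs hp) (h.le_youngInv ?_)
  have := h.map_mul_le (div_nonneg hs.le hp.le) ((div_le_one hp).2 (by linarith)) zero_le_one
  rw [mul_one] at this
  refine this.trans ?_
  rw [div_mul_eq_mul_div, div_le_iff₀ hp]
  nlinarith

theorem youngInv_mul_le (h : IsYoung Φ) {m t : ℝ} (hm : 1 ≤ m) (ht : 0 < t) (hΦt : 0 < Φ t) :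
    youngInv Φ (m * Φ t) ≤ m * t := by
  by_contra! hlt
  obtain ⟨r, hr1, hr2⟩ := exists_between hlt
  have hr0 : 0 < r := (by positivity : 0 < m * t).trans hr1
  have h1 := le_of_lt_youngInv hr0.le hr2
  have htr : t ≤ r := by nlinarith
  have h2 := h.map_mul_le (div_nonneg ht.le hr0.le) ((div_le_one hr0).2 htr) hr0.le
  rw [div_mul_cancel₀ t hr0.ne', div_mul_eq_mul_div, le_div_iff₀ hr0] at h2
  nlinarith

end IsYoung

section Scalar

variable {ι : Type*} [Fintype ι] {Φ : ℝ → ℝ} {Φi : ι → ℝ → ℝ}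

theorem young_le_sum_of_prod_youngInv_le (hΦ : IsYoung Φ) (hΦi : ∀ i, IsYoung (Φi i))
    {C : ℝ} (hC : 0 < C) (H : ∀ t ≥ 0, (∏ i, youngInv (Φi i) t) ≤ C * youngInv Φ t)
    (t : ι → ℝ) (ht : ∀ i, 0 ≤ t i) : Φ ((∏ i, t i) / C) ≤ ∑ i, Φi i (t i) := by
  have hnn : ∀ i, 0 ≤ Φi i (t i) := fun i => (hΦi i).nonneg _ (ht i)
  have hs : 0 ≤ ∑ i, Φi i (t i) := Finset.sum_nonneg fun i _ => hnn i
  have h1 : ∏ i, t i ≤ ∏ i, youngInv (Φi i) (∑ j, Φi j (t j)) :=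
    Finset.prod_le_prod (fun i _ => ht i) fun i _ => (hΦi i).le_youngInv
      (Finset.single_le_sum (f := fun j => Φi j (t j)) (fun j _ => hnn j) (Finset.mem_univ i))
  refine (hΦ.mono (div_nonneg (Finset.prod_nonneg fun i _ => ht i) hC.le) ?_).trans
    (hΦ.map_youngInv_le hs)
  rw [div_le_iff₀' hC]
  exact h1.trans (H _ hs)

theorem prod_youngInv_le_of_young_le_sum [Nonempty ι] (hΦ : IsYoung Φ)
    (hΦi : ∀ i, IsYoung (Φi i)) {C : ℝ} (hC : 0 < C)
    (H : ∀ t : ι → ℝ, (∀ i, 0 ≤ t i) → Φ ((∏ i, t i) / C) ≤ ∑ i, Φi i (t i))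
    (s : ℝ) (hs : 0 ≤ s) :
    (∏ i, youngInv (Φi i) s) ≤ C * Fintype.card ι * youngInv Φ s := by
  have hm : (0 : ℝ) < Fintype.card ι := by exact_mod_cast Fintype.card_pos
  have hm1 : (1 : ℝ) ≤ Fintype.card ι := by exact_mod_cast Fintype.card_pos (α := ι)
  have hP : 0 ≤ ∏ i, youngInv (Φi i) s :=
    Finset.prod_nonneg fun i _ => (hΦi i).youngInv_nonneg s
  have h1 : Φ ((∏ i, youngInv (Φi i) s) / C) ≤ Fintype.card ι * s := by
    refine (H _ fun i => (hΦi i).youngInv_nonneg s).trans ?_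
    refine (Finset.sum_le_sum fun i _ => (hΦi i).map_youngInv_le hs).trans ?_
    simp
  have h2 := hΦ.map_mul_le (inv_nonneg.2 hm.le) (inv_le_one_of_one_le₀ hm1)
    (div_nonneg hP hC.le)
  have h3 := hΦ.le_youngInv (h2.trans ((inv_mul_le_iff₀ hm).2 h1))
  rw [inv_mul_le_iff₀ hm, div_le_iff₀ hC] at h3
  linarith

theorem prod_youngInv_le_of_pos (hΦ : IsYoung Φ) (hΦi : ∀ i, IsYoung (Φi i)) {C : ℝ}
    (hC : 0 < C) (H : ∀ t > 0, (∏ i, youngInv (Φi i) t) ≤ C * youngInv Φ t)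
    (t : ℝ) (ht : 0 ≤ t) : (∏ i, youngInv (Φi i) t) ≤ C * youngInv Φ t := by
  rcases ht.eq_or_lt with rfl | ht
  · rw [← div_le_iff₀' hC]
    refine le_of_forall_gt_imp_ge_of_dense fun r hr => ?_
    have hΦr := hΦ.lt_of_youngInv_lt hr
    rw [div_le_iff₀' hC]
    refine (Finset.prod_le_prod (fun i _ => (hΦi i).youngInv_nonneg 0)
      fun i _ => (hΦi i).monotone_youngInv (half_pos hΦr).le).trans
      ((H _ (half_pos hΦr)).trans (mul_le_mul_of_nonneg_left ?_ hC.le))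
    exact csInf_le ⟨0, fun _ hx => hx.1⟩
      ⟨(hΦ.youngInv_nonneg 0).trans hr.le, half_lt_self hΦr⟩
  · exact H t ht

end Scalar

section Weak

variable {α : Type*} [MeasurableSpace α] {μ : Measure α}

theorem wOrliczNorm_lt_top_iff {Φ : ℝ → ℝ} {f : α → ℝ} :
    wOrliczNorm μ Φ f < ⊤ ↔ (wOrliczSet μ Φ f).Nonempty := by
  simp [wOrliczNorm, iInf_lt_iff, Set.Nonempty]

variable {ι : Type*} [Fintype ι] {Φ : ℝ → ℝ} {Φi : ι → ℝ → ℝ}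

theorem prod_mem_wOrliczSet [Nonempty ι] (hΦ : IsYoung Φ) (hΦi : ∀ i, IsYoung (Φi i))
    {C : ℝ} (hC : 0 < C) (H : ∀ t ≥ 0, (∏ i, youngInv (Φi i) t) ≤ C * youngInv Φ t)
    {F : ι → α → ℝ} {b : ι → ℝ} (hb : ∀ i, b i ∈ wOrliczSet μ (Φi i) (F i)) :
    2 ^ Fintype.card ι * C * Fintype.card ι * ∏ i, b i ∈
      wOrliczSet μ Φ (fun x => ∏ i, F i x) := by
  have hm : (0 : ℝ) < Fintype.card ι := by exact_mod_cast Fintype.card_pos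
  have hm1 : (1 : ℝ) ≤ Fintype.card ι := by exact_mod_cast Fintype.card_pos (α := ι)
  have hB : 0 < ∏ i, b i := Finset.prod_pos fun i _ => (hb i).1
  refine ⟨by positivity, fun t ht => ?_⟩
  rcases (hΦ.nonneg t ht.le).eq_or_lt with h0 | h0
  · simp [← h0]
  set s : ℝ := Fintype.card ι * Φ t with hs
  have hs0 : 0 < s := by positivity
  have hsub : {x | t < |∏ i, F i x| / (2 ^ Fintype.card ι * C * Fintype.card ι * ∏ i, b i)} ⊆
      ⋃ i, {x | 2 * youngInv (Φi i) s < |F i x| / b i} := by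
    intro x hx
    by_contra hcon
    simp only [Set.mem_iUnion, Set.mem_ofPred_eq, not_exists, not_lt] at hcon hx
    have h1 : ∏ i, |F i x| / b i ≤ ∏ i, 2 * youngInv (Φi i) s :=
      Finset.prod_le_prod (fun i _ => div_nonneg (abs_nonneg _) (hb i).1.le) fun i _ => hcon i
    rw [Finset.prod_div_distrib, ← Finset.abs_prod, Finset.prod_mul_distrib,
      Finset.prod_const, Finset.card_univ, div_le_iff₀ hB] at h1
    rw [lt_div_iff₀ (by positivity)] at hx
    have h2 : ∏ i, youngInv (Φi i) s ≤ C * (Fintype.card ι * t) :=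
      (H s hs0.le).trans (mul_le_mul_of_nonneg_left (hΦ.youngInv_mul_le hm1 ht h0) hC.le)
    have h3 : 2 ^ Fintype.card ι * (∏ i, youngInv (Φi i) s) * ∏ i, b i ≤
        2 ^ Fintype.card ι * (C * (Fintype.card ι * t)) * ∏ i, b i := by gcongr
    linarith
  have hμ : ∀ i, μ {x | 2 * youngInv (Φi i) s < |F i x| / b i} ≤ (ENNReal.ofReal s)⁻¹ := by
    intro i
    have hg := (hΦi i).youngInv_pos hs0
    rw [ENNReal.le_inv_iff_mul_le, mul_comm]
    refine le_trans ?_ ((hb i).2 (2 * youngInv (Φi i) s) (by positivity))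
    gcongr
    exact ((hΦi i).lt_of_youngInv_lt (by linarith)).le
  calc ENNReal.ofReal (Φ t) * _
      ≤ ENNReal.ofReal (Φ t) * ∑ _i : ι, (ENNReal.ofReal s)⁻¹ := by
        gcongr
        exact (measure_mono hsub).trans ((measure_iUnion_fintype_le _ _).trans
          (Finset.sum_le_sum fun i _ => hμ i))
    _ = ENNReal.ofReal s * (ENNReal.ofReal s)⁻¹ := by
        rw [Finset.sum_const, Finset.card_univ, nsmul_eq_mul, hs,
          ENNReal.ofReal_mul hm.le, ENNReal.ofReal_natCast]
        ring
    _ ≤ 1 := ENNReal.mul_inv_le_one _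

theorem wOrliczNorm_prod_le [Nonempty ι] (hΦ : IsYoung Φ) (hΦi : ∀ i, IsYoung (Φi i))
    {C : ℝ} (hC : 0 < C) (H : ∀ t ≥ 0, (∏ i, youngInv (Φi i) t) ≤ C * youngInv Φ t)
    {F : ι → α → ℝ} (hF : ∀ i, wOrliczNorm μ (Φi i) (F i) < ⊤) :
    wOrliczNorm μ Φ (fun x => ∏ i, F i x) ≤
      ENNReal.ofReal (2 ^ Fintype.card ι * C * Fintype.card ι) *
        ∏ i, wOrliczNorm μ (Φi i) (F i) := by
  set M : ℝ := 2 ^ Fintype.card ι * C * Fintype.card ι with hM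
  have hM0 : 0 ≤ M := by positivity
  have key : ∀ ε : ℝ, 0 < ε → wOrliczNorm μ Φ (fun x => ∏ i, F i x) ≤
      ENNReal.ofReal (M * ∏ i, ((wOrliczNorm μ (Φi i) (F i)).toReal + ε)) := by
    intro ε hε
    have hex : ∀ i, ∃ b ∈ wOrliczSet μ (Φi i) (F i),
        b < (wOrliczNorm μ (Φi i) (F i)).toReal + ε := by
      intro i
      have hlt : wOrliczNorm μ (Φi i) (F i) <
          ENNReal.ofReal ((wOrliczNorm μ (Φi i) (F i)).toReal + ε) := by
        rw [ENNReal.lt_ofReal_iff_toReal_lt (hF i).ne]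
        linarith
      conv_lhs at hlt => rw [wOrliczNorm]
      simp only [iInf_lt_iff] at hlt
      obtain ⟨b, hb, hlt⟩ := hlt
      exact ⟨b, hb, (ENNReal.ofReal_lt_ofReal_iff (by positivity)).1 hlt⟩
    choose b hb hlt using hex
    refine (iInf₂_le _ (prod_mem_wOrliczSet hΦ hΦi hC H hb)).trans (ENNReal.ofReal_le_ofReal ?_)
    exact mul_le_mul_of_nonneg_left
      (Finset.prod_le_prod (fun i _ => (hb i).1.le) fun i _ => (hlt i).le) hM0
  have hcont : Continuous fun ε : ℝ =>
      ENNReal.ofReal (M * ∏ i, ((wOrliczNorm μ (Φi i) (F i)).toReal + ε)) :=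
    ENNReal.continuous_ofReal.comp (by fun_prop)
  have hlim := (hcont.tendsto 0).mono_left (nhdsWithin_le_nhds (s := Set.Ioi 0))
  refine (ge_of_tendsto hlim (eventually_mem_nhdsWithin.mono key)).trans_eq ?_
  rw [ENNReal.ofReal_mul hM0]
  simp only [add_zero]
  rw [ENNReal.ofReal_prod_of_nonneg fun i _ => ENNReal.toReal_nonneg]
  simp only [ENNReal.ofReal_toReal (hF _).ne]

theorem memwOrlicz_youngInv_comp (hΦ : IsYoung Φ) {v : α → ℝ} (hv : Measurable v)
    (hv0 : ∀ x, 0 ≤ v x) (hμ : ∀ r > 0, μ {x | v x ≤ r} = ENNReal.ofReal r) :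
    MemwOrlicz μ Φ (fun x => youngInv Φ (v x)⁻¹) := by
  refine ⟨hΦ.monotone_youngInv.measurable.comp hv.inv,
    wOrliczNorm_lt_top_iff.2 ⟨1, one_pos, fun t ht => ?_⟩⟩
  rcases (hΦ.nonneg t ht.le).eq_or_lt with h0 | h0
  · simp [← h0]
  have hsub : {x | t < |youngInv Φ (v x)⁻¹| / 1} ⊆ {x | v x ≤ (Φ t)⁻¹} := by
    intro x hx
    simp only [Set.mem_ofPred_eq, div_one, abs_of_nonneg (hΦ.youngInv_nonneg _)] at hx ⊢
    rcases (hv0 x).eq_or_lt with h | h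
    · rw [← h]; positivity
    · exact (le_inv_comm₀ h0 h).1 (IsYoung.le_of_lt_youngInv ht.le hx)
  calc ENNReal.ofReal (Φ t) * _ ≤ ENNReal.ofReal (Φ t) * μ {x | v x ≤ (Φ t)⁻¹} := by gcongr
    _ = 1 := by
      rw [hμ _ (inv_pos.2 h0), ← ENNReal.ofReal_mul h0.le, mul_inv_cancel₀ h0.ne',
        ENNReal.ofReal_one]

theorem exists_prod_youngInv_le_of_memwOrlicz_prod (hΦ : IsYoung Φ)
    (hΦi : ∀ i, IsYoung (Φi i)) {v : α → ℝ} (hv : Measurable v)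
    (hv0 : ∀ x, 0 ≤ v x) (hμ0 : μ {x | v x = 0} = 0)
    (hμ : ∀ r > 0, μ {x | v x ≤ r} = ENNReal.ofReal r)
    (H : ∀ F : ι → α → ℝ, (∀ i, MemwOrlicz μ (Φi i) (F i)) →
      MemwOrlicz μ Φ (fun x => ∏ i, F i x)) :
    ∃ C > 0, ∀ t ≥ 0, (∏ i, youngInv (Φi i) t) ≤ C * youngInv Φ t := by
  obtain ⟨b, hb, hbt⟩ := wOrliczNorm_lt_top_iff.1
    (H (fun i x => youngInv (Φi i) (v x)⁻¹)
      fun i => memwOrlicz_youngInv_comp (hΦi i) hv hv0 hμ).2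
  refine ⟨b, hb, prod_youngInv_le_of_pos hΦ hΦi hb fun s hs => ?_⟩
  rw [← div_le_iff₀' hb]
  refine le_of_forall_lt_imp_le_of_dense fun t ht => ?_
  rcases le_or_gt t 0 with ht0 | ht0
  · exact ht0.trans (hΦ.youngInv_nonneg s)
  refine hΦ.le_youngInv ?_
  have hsub : {x | v x ≤ s⁻¹} ⊆
      {x | t < |∏ i, youngInv (Φi i) (v x)⁻¹| / b} ∪ {x | v x = 0} := by
    intro x hx
    rcases (hv0 x).eq_or_lt with h | h
    · exact Or.inr h.symm
    · refine Or.inl (ht.trans_le (div_le_div_of_nonneg_right ?_ hb.le))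
      refine le_trans ?_ (le_abs_self _)
      exact Finset.prod_le_prod (fun i _ => (hΦi i).youngInv_nonneg s)
        fun i _ => (hΦi i).monotone_youngInv ((le_inv_comm₀ h hs).1 hx)
  have h1 : ENNReal.ofReal s⁻¹ ≤ μ {x | t < |∏ i, youngInv (Φi i) (v x)⁻¹| / b} := by
    rw [← hμ _ (inv_pos.2 hs)]
    refine (measure_mono hsub).trans ((measure_union_le _ _).trans ?_)
    rw [hμ0, add_zero]
  have h2 : ENNReal.ofReal (Φ t) * ENNReal.ofReal s⁻¹ ≤ 1 :=
    (mul_le_mul_right h1 _).trans (hbt t ht0)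
  rw [← ENNReal.ofReal_mul (hΦ.nonneg t ht0.le), ENNReal.ofReal_le_one,
    ← div_eq_mul_inv, div_le_one hs] at h2
  exact h2

end Weak

theorem exists_measurable_volume_sublevel_eq {n : ℕ} (hn : 0 < n) :
    ∃ v : EuclideanSpace ℝ (Fin n) → ℝ, Measurable v ∧ (∀ x, 0 ≤ v x) ∧
      volume {x | v x = 0} = 0 ∧ ∀ r > 0, volume {x | v x ≤ r} = ENNReal.ofReal r := by
  have : Nonempty (Fin n) := ⟨⟨0, hn⟩⟩
  set V := (volume (Metric.ball (0 : EuclideanSpace ℝ (Fin n)) 1)).toReal with hV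
  have hfin : volume (Metric.ball (0 : EuclideanSpace ℝ (Fin n)) 1) ≠ ⊤ :=
    measure_ball_lt_top.ne
  have hV0 : 0 < V := ENNReal.toReal_pos (Metric.measure_ball_pos _ _ one_pos).ne' hfin
  refine ⟨fun x => V * ‖x‖ ^ n, by fun_prop, fun x => by positivity, ?_, fun r hr => ?_⟩
  · have : {x : EuclideanSpace ℝ (Fin n) | V * ‖x‖ ^ n = 0} = {0} := by
      ext x
      simp [hV0.ne', hn.ne']
    rw [this, measure_singleton]
  · have hρ : 0 ≤ (r / V) ^ ((n : ℝ)⁻¹) := by positivity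
    have hρn : ((r / V) ^ ((n : ℝ)⁻¹)) ^ n = r / V :=
      Real.rpow_inv_natCast_pow (by positivity) hn.ne'
    have : {x : EuclideanSpace ℝ (Fin n) | V * ‖x‖ ^ n ≤ r} =
        Metric.closedBall 0 ((r / V) ^ ((n : ℝ)⁻¹)) := by
      ext x
      rw [Set.mem_ofPred_eq, mem_closedBall_zero_iff,
        ← pow_le_pow_iff_left₀ (norm_nonneg x) hρ hn.ne', hρn, le_div_iff₀' hV0]
    rw [this, Measure.addHaar_closedBall _ _ hρ, finrank_euclideanSpace_fin, hρn,
      ← ENNReal.ofReal_toReal hfin, ← hV, ← ENNReal.ofReal_mul (by positivity),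
      div_mul_cancel₀ r hV0.ne']

/-- Generalized Hölder's inequality in weak Orlicz spaces: four equivalent conditions. -/
theorem generalized_holder_weak_orlicz_tfae {n : ℕ} (hn : 0 < n) (m : ℕ) (hm : 2 ≤ m)
    (Φ : ℝ → ℝ) (Φi : Fin m → ℝ → ℝ)
    (hΦ : IsYoung Φ) (hΦi : ∀ i, IsYoung (Φi i)) :
    List.TFAE
      [ ∃ C > 0, ∀ t ≥ 0, (∏ i, youngInv (Φi i) t) ≤ C * youngInv Φ t,
        ∃ C > 0, ∀ t : Fin m → ℝ, (∀ i, 0 ≤ t i) →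
          Φ ((∏ i, t i) / C) ≤ ∑ i, Φi i (t i),
        ∃ M > 0, ∀ F : Fin m → EuclideanSpace ℝ (Fin n) → ℝ,
          (∀ i, MemwOrlicz (volume : Measure (EuclideanSpace ℝ (Fin n))) (Φi i) (F i)) →
          wOrliczNorm volume Φ (fun x => ∏ i, F i x) ≤
            ENNReal.ofReal M * ∏ i, wOrliczNorm volume (Φi i) (F i),
        ∀ F : Fin m → EuclideanSpace ℝ (Fin n) → ℝ,
          (∀ i, MemwOrlicz (volume : Measure (EuclideanSpace ℝ (Fin n))) (Φi i) (F i)) →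
          MemwOrlicz (volume : Measure (EuclideanSpace ℝ (Fin n))) Φ (fun x => ∏ i, F i x) ] := by
  have : Nonempty (Fin m) := ⟨⟨0, by omega⟩⟩
  tfae_have 1 → 2 := fun ⟨C, hC, H⟩ => ⟨C, hC, young_le_sum_of_prod_youngInv_le hΦ hΦi hC H⟩
  tfae_have 2 → 1 := fun ⟨C, hC, H⟩ =>
    ⟨C * Fintype.card (Fin m), mul_pos hC (by exact_mod_cast Fintype.card_pos),
      prod_youngInv_le_of_young_le_sum hΦ hΦi hC H⟩
  tfae_have 1 → 3 := fun ⟨C, hC, H⟩ =>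
    ⟨2 ^ Fintype.card (Fin m) * C * Fintype.card (Fin m),
      mul_pos (by positivity) (by exact_mod_cast Fintype.card_pos),
      fun _ hF => wOrliczNorm_prod_le hΦ hΦi hC H fun i => (hF i).2⟩
  tfae_have 3 → 4 := fun ⟨M, _, H⟩ F hF =>
    ⟨Finset.measurable_fun_prod _ fun i _ => (hF i).1, (H F hF).trans_lt
      (ENNReal.mul_lt_top ENNReal.ofReal_lt_top (ENNReal.prod_lt_top fun i _ => (hF i).2))⟩
  tfae_have 4 → 1 := by
    obtain ⟨v, hv, hv0, hμ0, hμ⟩ := exists_measurable_volume_sublevel_eq hn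
    exact exists_prod_youngInv_le_of_memwOrlicz_prod hΦ hΦi hv hv0 hμ0 hμ
  tfae_finish
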